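/- arXiv:1701.01961 — 3 statements merged into one kernel-verified Lean document; each statement's English description precedes it below -/
import Mathlib

section
/- There is an absolute constant c > 0 such that the following holds. Let t* ∈ R^d, ρ > 0 and r(ρ) > 0. If there exists v ∈ R^d with ‖v − t*‖_1 ≤ ρ/20 and |supp(v)| ≤ c ρ²/r(ρ)², then Δ(ρ) := inf_{h ∈ ρ S_1^{d−1} ∩ r(ρ) B_2^d} sup_{z ∈ Γ_{t*}(ρ)} ⟨h, z⟩ ≥ 4ρ/5, where Γ_{t*}(ρ) is the union over all u ∈ R^d with ‖u − t*‖_1 ≤ ρ/20 of the subdifferential of the ℓ_1-norm at u. -/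
open Finset

noncomputable section

/-- `ℓ₁` norm on `ℝ^d`. -/
def l1norm {d : ℕ} (t : Fin d → ℝ) : ℝ := ∑ j, |t j|

/-- `ℓ₂` norm on `ℝ^d`. -/
def l2norm {d : ℕ} (t : Fin d → ℝ) : ℝ := (∑ j, t j ^ 2) ^ ((1 : ℝ) / 2)

/-- Euclidean pairing on `ℝ^d`. -/
def ip {d : ℕ} (h z : Fin d → ℝ) : ℝ := ∑ j, h j * z j

/-- Subdifferential of the `ℓ₁`-norm at `u`. -/
def subdiffL1 {d : ℕ} (u : Fin d → ℝ) : Set (Fin d → ℝ) :=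
  {z : Fin d → ℝ | ∀ h : Fin d → ℝ, l1norm u + ip z h ≤ l1norm (u + h)}

/-- `Γ_{t*}(ρ)`: union of the subdifferentials of `‖·‖₁` at all points `u` with
`‖u − t*‖₁ ≤ ρ/20`. -/
def GammaL1 {d : ℕ} (tstar : Fin d → ℝ) (ρ : ℝ) : Set (Fin d → ℝ) :=
  {z : Fin d → ℝ | ∃ u : Fin d → ℝ, l1norm (u - tstar) ≤ ρ / 20 ∧ z ∈ subdiffL1 u}

lemma l1norm_add_le {d : ℕ} (u h : Fin d → ℝ) : l1norm (u + h) ≤ l1norm u + l1norm h := by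
  unfold l1norm
  rw [← Finset.sum_add_distrib]
  exact Finset.sum_le_sum fun j _ => abs_add_le (u j) (h j)

lemma ip_le_l1norm_of_mem_subdiffL1 {d : ℕ} {u z : Fin d → ℝ} (hz : z ∈ subdiffL1 u)
    (h : Fin d → ℝ) : ip h z ≤ l1norm h := by
  have hcomm : ip h z = ip z h := Finset.sum_congr rfl fun j _ => mul_comm _ _
  have := hz h
  have := l1norm_add_le u h
  linarith

lemma bddAbove_ip_GammaL1 {d : ℕ} (tstar : Fin d → ℝ) (ρ : ℝ) (h : Fin d → ℝ) :
    BddAbove {a : ℝ | ∃ z ∈ GammaL1 tstar ρ, a = ip h z} := by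
  refine ⟨l1norm h, ?_⟩
  rintro a ⟨z, ⟨u, -, hz⟩, rfl⟩
  exact ip_le_l1norm_of_mem_subdiffL1 hz h

lemma mem_subdiffL1_of_abs_le_one {d : ℕ} {u z : Fin d → ℝ} (hz : ∀ j, |z j| ≤ 1)
    (huz : ∀ j, z j * u j = |u j|) : z ∈ subdiffL1 u := by
  intro h
  unfold l1norm ip
  rw [← Finset.sum_add_distrib]
  refine Finset.sum_le_sum fun j _ => ?_
  calc |u j| + z j * h j = z j * (u j + h j) := by rw [mul_add, huz]
    _ ≤ |z j * (u j + h j)| := le_abs_self _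
    _ = |z j| * |u j + h j| := abs_mul _ _
    _ ≤ |(u + h) j| := mul_le_of_le_one_left (abs_nonneg _) (hz j)

lemma abs_coe_sign_le_one (x : ℝ) : |(SignType.sign x : ℝ)| ≤ 1 := by
  rcases lt_trichotomy x 0 with hx | hx | hx <;> simp [hx]

/-- A subgradient at `v` aligned with `h` off the support of `v`. -/
lemma exists_mem_subdiffL1_le_ip {d : ℕ} (v h : Fin d → ℝ) :
    ∃ z ∈ subdiffL1 v,
      l1norm h - 2 * ∑ j ∈ univ.filter (fun j => v j ≠ 0), |h j| ≤ ip h z := by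
  refine ⟨fun j => if v j ≠ 0 then (SignType.sign (v j) : ℝ) else (SignType.sign (h j) : ℝ),
    mem_subdiffL1_of_abs_le_one (fun j => ?_) (fun j => ?_), ?_⟩
  · split_ifs <;> exact abs_coe_sign_le_one _
  · by_cases hv : v j = 0
    · simp [hv]
    · simp [hv, sign_mul_self]
  · unfold l1norm ip
    rw [Finset.mul_sum, Finset.sum_filter, ← Finset.sum_sub_distrib]
    refine Finset.sum_le_sum fun j _ => ?_
    by_cases hv : v j = 0
    · simp [hv, self_mul_sign]
    · have hs := abs_le.1 (abs_mul (h j) (SignType.sign (v j) : ℝ) |>.le.trans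
        (mul_le_of_le_one_right (abs_nonneg _) (abs_coe_sign_le_one _)))
      simp only [ne_eq, hv, not_false_eq_true, if_true]
      linarith [hs.1]

lemma sq_sum_abs_le_card_mul_l2norm_sq {d : ℕ} (s : Finset (Fin d)) (h : Fin d → ℝ) :
    (∑ j ∈ s, |h j|) ^ 2 ≤ s.card * l2norm h ^ 2 := by
  have hnorm : l2norm h ^ 2 = ∑ j, h j ^ 2 := by
    unfold l2norm
    rw [← Real.sqrt_eq_rpow, Real.sq_sqrt (Finset.sum_nonneg fun j _ => sq_nonneg _)]
  calc (∑ j ∈ s, |h j|) ^ 2 ≤ s.card * ∑ j ∈ s, |h j| ^ 2 := sq_sum_le_card_mul_sum_sq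
    _ ≤ s.card * l2norm h ^ 2 := by
      rw [hnorm]
      simp only [sq_abs]
      gcongr
      exact Finset.subset_univ s

/-- **the sparsity equation for `ℓ₁`-regularization.** There is an absolute
constant `c > 0` such that whenever some `v` with `‖v − t*‖₁ ≤ ρ/20` and
`|supp v| ≤ c ρ²/r(ρ)²` exists, one has
`Δ(ρ) = inf_{h ∈ ρS₁^{d−1} ∩ r(ρ)B₂^d} sup_{z ∈ Γ_{t*}(ρ)} ⟨h, z⟩ ≥ 4ρ/5`. -/
theorem stmt7 :
    ∃ c : ℝ, 0 < c ∧
      ∀ (d : ℕ) (tstar : Fin d → ℝ) (ρ rρ : ℝ), 0 < ρ → 0 < rρ →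
        (∃ v : Fin d → ℝ, l1norm (v - tstar) ≤ ρ / 20 ∧
          ((univ.filter fun j => v j ≠ 0).card : ℝ) ≤ c * ρ ^ 2 / rρ ^ 2) →
        ∀ h : Fin d → ℝ, l1norm h = ρ → l2norm h ≤ rρ →
          4 * ρ / 5 ≤ sSup {a : ℝ | ∃ z ∈ GammaL1 tstar ρ, a = ip h z} := by
  refine ⟨1 / 100, by norm_num, ?_⟩
  rintro d tstar ρ rρ hρ hr ⟨v, hv, hcard⟩ h h1 h2
  obtain ⟨z, hz, hle⟩ := exists_mem_subdiffL1_le_ip v h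
  refine le_trans ?_ (le_csSup (bddAbove_ip_GammaL1 tstar ρ h) ⟨z, ⟨v, hv, hz⟩, rfl⟩)
  have h2_nonneg : 0 ≤ l2norm h := by unfold l2norm; positivity
  have hsq : (∑ j ∈ univ.filter (fun j => v j ≠ 0), |h j|) ^ 2 ≤ (ρ / 10) ^ 2 := by
    refine (sq_sum_abs_le_card_mul_l2norm_sq _ h).trans ?_
    calc _ ≤ 1 / 100 * ρ ^ 2 / rρ ^ 2 * rρ ^ 2 := by gcongr
      _ = (ρ / 10) ^ 2 := by field_simp; norm_num
  have := abs_le_of_sq_le_sq hsq (by positivity)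
  linarith [le_abs_self (∑ j ∈ univ.filter (fun j => v j ≠ 0), |h j|)]
end
end

section
/- Fix a sample (x_i,y_i)_{i∈[N]} in 𝒳×R, an equipartition (B_1,…,B_K) of [N], a convex class F of functions on 𝒳 contained in a normed space (E,‖·‖), f* ∈ F, ζ_i = y_i − f*(x_i), λ > 0, ρ_K > 0, and let Γ_{f*}(ρ_K) be the union of subdifferentials of ‖·‖ at points f** with ‖f**−f*‖ ≤ ρ_K/20. Suppose that for every f ∈ F with ‖f−f*‖ = ρ_K one has MOM_K[(f−f*)² − 2ζ(f−f*)] + λ·sup_{z*∈Γ_{f*}(ρ_K)} z*(f−f*) > λρ_K/10, where MOM_K[h] > u means that the supremum of the set of medians of the block averages ((K/N)∑_{i∈B_k} h_i)_{k∈[K]}, with h_i = (f−f*)(x_i)² − 2ζ_i(f−f*)(x_i), exceeds u. Then the same strict inequality holds for every f ∈ F with ‖f−f*‖ ≥ ρ_K. -/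
open Finset

noncomputable section

/-- The set of medians of a vector `z ∈ ℝ^K`. -/
def medianSet {K : ℕ} (z : Fin K → ℝ) : Set ℝ :=
  {x : ℝ | (K : ℝ) / 2 ≤ ((univ.filter fun k => z k ≤ x).card : ℝ) ∧
    (K : ℝ) / 2 ≤ ((univ.filter fun k => x ≤ z k).card : ℝ)}

/-- If at least half of the coordinates satisfy `p`, then some coordinate satisfying `p` is a lower
bound for at least half of the coordinates. -/
lemma exists_coord_of_half_le_card_filter {K : ℕ} (hK : 0 < K) (z : Fin K → ℝ) (p : ℝ → Prop)
    [DecidablePred p]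
    (h : (K : ℝ) / 2 ≤ ((univ.filter fun k => p (z k)).card : ℝ)) :
    ∃ j, p (z j) ∧ (K : ℝ) / 2 ≤ ((univ.filter fun k => z j ≤ z k).card : ℝ) := by
  have hKr : (0 : ℝ) < K := by exact_mod_cast hK
  have hne : (univ.filter fun k => p (z k)).Nonempty := by
    rw [← Finset.card_pos]
    have : (0 : ℝ) < ((univ.filter fun k => p (z k)).card : ℝ) := by linarith
    exact_mod_cast this
  obtain ⟨j, hj, hmin⟩ := Finset.exists_min_image _ z hne
  refine ⟨j, (Finset.mem_filter.mp hj).2, h.trans ?_⟩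
  exact_mod_cast Finset.card_le_card fun k hk =>
    Finset.mem_filter.mpr ⟨Finset.mem_univ k, hmin k hk⟩

lemma exists_mem_medianSet_ge {K : ℕ} (hK : 0 < K) (z : Fin K → ℝ) (a : ℝ)
    (h : (K : ℝ) / 2 ≤ ((univ.filter fun k => a ≤ z k).card : ℝ)) :
    ∃ b ∈ medianSet z, a ≤ b := by
  obtain ⟨j₀, hj₀, hc₀⟩ :=
    exists_coord_of_half_le_card_filter hK z (fun b => a ≤ b) h
  let C := univ.filter fun j => (K : ℝ) / 2 ≤ ((univ.filter fun k => z j ≤ z k).card : ℝ)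
  have hj₀C : j₀ ∈ C := Finset.mem_filter.mpr ⟨Finset.mem_univ _, hc₀⟩
  obtain ⟨j, hj, hmax⟩ := Finset.exists_max_image C z ⟨j₀, hj₀C⟩
  refine ⟨z j, ⟨?_, (Finset.mem_filter.mp hj).2⟩, hj₀.trans (hmax _ hj₀C)⟩
  by_contra! hlt
  have hsum := Finset.card_filter_add_card_filter_not (s := (univ : Finset (Fin K)))
    (fun k => z k ≤ z j)
  simp only [not_le, Finset.card_univ, Fintype.card_fin] at hsum
  have hsum' : ((univ.filter fun k => z k ≤ z j).card : ℝ) +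
      ((univ.filter fun k => z j < z k).card : ℝ) = K := by exact_mod_cast hsum
  obtain ⟨i, hi, hci⟩ := exists_coord_of_half_le_card_filter hK z (fun b => z j < b) (by linarith)
  exact (hmax i (Finset.mem_filter.mpr ⟨Finset.mem_univ _, hci⟩)).not_gt hi

lemma medianSet_nonempty {K : ℕ} (hK : 0 < K) (z : Fin K → ℝ) : (medianSet z).Nonempty := by
  have : Nonempty (Fin K) := ⟨⟨0, hK⟩⟩
  obtain ⟨j, hj⟩ := Finite.exists_min z
  obtain ⟨b, hb, -⟩ := exists_mem_medianSet_ge hK z (z j) (by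
    rw [Finset.filter_true_of_mem fun k _ => hj k, Finset.card_univ, Fintype.card_fin]
    linarith [(Nat.cast_nonneg K : (0 : ℝ) ≤ K)])
  exact ⟨b, hb⟩

lemma bddAbove_medianSet {K : ℕ} (hK : 0 < K) (z : Fin K → ℝ) : BddAbove (medianSet z) := by
  have : Nonempty (Fin K) := ⟨⟨0, hK⟩⟩
  obtain ⟨j, hj⟩ := Finite.exists_max z
  refine ⟨z j, fun a ha => ?_⟩
  obtain ⟨i, hi, -⟩ :=
    exists_coord_of_half_le_card_filter hK z (fun b => a ≤ b) ha.2
  exact hi.trans (hj i)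

lemma sSup_medianSet_mono {K : ℕ} {w z : Fin K → ℝ} (h : ∀ k, w k ≤ z k) :
    sSup (medianSet w) ≤ sSup (medianSet z) := by
  rcases Nat.eq_zero_or_pos K with rfl | hK
  · exact le_of_eq (by rw [Subsingleton.elim w z])
  refine csSup_le (medianSet_nonempty hK w) fun a ha => ?_
  obtain ⟨b, hb, hab⟩ := exists_mem_medianSet_ge hK z a (ha.2.trans (by
    exact_mod_cast Finset.card_le_card
      (Finset.monotone_filter_right univ fun k _ (hk : a ≤ w k) => hk.trans (h k))))
  exact hab.trans (le_csSup (bddAbove_medianSet hK z) hb)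

open scoped Pointwise in
lemma sSup_medianSet_smul {K : ℕ} {t : ℝ} (ht : 0 < t) (z : Fin K → ℝ) :
    sSup (medianSet (t • z)) = t * sSup (medianSet z) := by
  have : medianSet (t • z) = t • medianSet z := by
    ext a
    rw [Set.mem_smul_set_iff_inv_smul_mem₀ ht.ne']
    simp only [medianSet, Set.mem_ofPred_eq, Pi.smul_apply, smul_eq_mul,
      le_inv_mul_iff₀ ht, inv_mul_le_iff₀ ht]
  rw [this, Real.sSup_smul_of_nonneg ht.le, smul_eq_mul]

/-- **homogeneity argument.** Fix a sample `(x_i, y_i)_{i ∈ [N]}`, an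
equipartition `(B_1, …, B_K)` of `[N]`, a convex class `F` of functions contained in a space
normed by `nrm`, `f* ∈ F`, `ζ_i = y_i − f*(x_i)`, `λ > 0`, `ρ_K > 0`, and let `Γ_{f*}(ρ_K)` be
the union of the subdifferentials of `nrm` at points `f**` with `nrm(f** − f*) ≤ ρ_K/20`.
If `MOM_K[(f−f*)² − 2ζ(f−f*)] + λ·sup_{z* ∈ Γ} z*(f−f*) > λρ_K/10` (sup-of-medians
convention) for every `f ∈ F` with `nrm(f − f*) = ρ_K`, then the same inequality holds for
every `f ∈ F` with `nrm(f − f*) ≥ ρ_K`. -/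
theorem stmt13 {𝒳 : Type*} {N K : ℕ}
    (x : Fin N → 𝒳) (y : Fin N → ℝ)
    (B : Fin K → Finset (Fin N))
    (hcard : ∀ k, (B k).card * K = N)
    (hdisj : ∀ k l, k ≠ l → Disjoint (B k) (B l))
    (hcover : ∀ i, ∃ k, i ∈ B k)
    (F : Set (𝒳 → ℝ)) (hFconv : Convex ℝ F)
    (nrm : (𝒳 → ℝ) → ℝ)
    (hnrm_nonneg : ∀ f, 0 ≤ nrm f)
    (hnrm_smul : ∀ (c : ℝ) (f : 𝒳 → ℝ), nrm (c • f) = |c| * nrm f)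
    (hnrm_add : ∀ f g : 𝒳 → ℝ, nrm (f + g) ≤ nrm f + nrm g)
    (fstar : 𝒳 → ℝ) (hfstar : fstar ∈ F)
    (lam ρK : ℝ) (hlam : 0 < lam) (hρK : 0 < ρK)
    (Γ : Set ((𝒳 → ℝ) →ₗ[ℝ] ℝ))
    (hΓ : Γ = {z : (𝒳 → ℝ) →ₗ[ℝ] ℝ | ∃ g : 𝒳 → ℝ,
      nrm (g - fstar) ≤ ρK / 20 ∧ ∀ h : 𝒳 → ℝ, nrm g + z h ≤ nrm (g + h)})
    (hsphere : ∀ f ∈ F, nrm (f - fstar) = ρK →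
      lam * ρK / 10 <
        sSup (medianSet (fun k => ((K : ℝ) / N) * ∑ i ∈ B k,
          ((f (x i) - fstar (x i)) ^ 2 - 2 * (y i - fstar (x i)) * (f (x i) - fstar (x i))))) +
        lam * sSup {v : ℝ | ∃ z ∈ Γ, v = z (f - fstar)}) :
    ∀ f ∈ F, ρK ≤ nrm (f - fstar) →
      lam * ρK / 10 <
        sSup (medianSet (fun k => ((K : ℝ) / N) * ∑ i ∈ B k,
          ((f (x i) - fstar (x i)) ^ 2 - 2 * (y i - fstar (x i)) * (f (x i) - fstar (x i))))) +
        lam * sSup {v : ℝ | ∃ z ∈ Γ, v = z (f - fstar)} := by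
  intro f hf hr
  have hr0 : 0 < nrm (f - fstar) := hρK.trans_le hr
  obtain ⟨t, htdef⟩ : ∃ t, t = ρK / nrm (f - fstar) := ⟨_, rfl⟩
  have ht : 0 < t := htdef ▸ div_pos hρK hr0
  have ht1 : t ≤ 1 := htdef ▸ (div_le_one hr0).mpr hr
  have hgF : fstar + t • (f - fstar) ∈ F := hFconv.add_smul_sub_mem hfstar hf ⟨ht.le, ht1⟩
  have hg : fstar + t • (f - fstar) - fstar = t • (f - fstar) := add_sub_cancel_left _ _
  have key := hsphere _ hgF (by
    rw [hg, hnrm_smul, abs_of_pos ht, htdef, div_mul_cancel₀ _ hr0.ne'])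
  have hlin : sSup {v : ℝ | ∃ z ∈ Γ, v = z (t • (f - fstar))} =
      t * sSup {v : ℝ | ∃ z ∈ Γ, v = z (f - fstar)} := by
    open scoped Pointwise in
    rw [← smul_eq_mul, ← Real.sSup_smul_of_nonneg ht.le]
    congr 1
    ext v
    simp only [Set.mem_smul_set, Set.mem_ofPred_eq, map_smul, smul_eq_mul]
    constructor
    · rintro ⟨z, hz, rfl⟩
      exact ⟨_, ⟨z, hz, rfl⟩, rfl⟩
    · rintro ⟨_, ⟨z, hz, rfl⟩, rfl⟩
      exact ⟨z, hz, rfl⟩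
  rw [hg, hlin] at key
  have hmom := key.trans_le (add_le_add_left ((sSup_medianSet_mono fun k => ?_).trans_eq
    (sSup_medianSet_smul ht fun k => ((K : ℝ) / N) * ∑ i ∈ B k,
      ((f (x i) - fstar (x i)) ^ 2 -
        2 * (y i - fstar (x i)) * (f (x i) - fstar (x i))))) _)
  · have hpos : 0 < lam * ρK / 10 := by positivity
    set m := sSup (medianSet fun k => ((K : ℝ) / N) * ∑ i ∈ B k,
      ((f (x i) - fstar (x i)) ^ 2 - 2 * (y i - fstar (x i)) * (f (x i) - fstar (x i))))
    set s := sSup {v : ℝ | ∃ z ∈ Γ, v = z (f - fstar)}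
    have hts : lam * ρK / 10 < t * (m + lam * s) := by linarith
    have hms : 0 < m + lam * s := pos_of_mul_pos_right (hpos.trans hts) ht.le
    exact hts.trans_le (mul_le_of_le_one_left hms.le ht1)
  · simp only [Pi.smul_apply, Pi.add_apply, Pi.sub_apply, smul_eq_mul, add_sub_cancel_left]
    have hc : (0 : ℝ) ≤ K / N := by positivity
    rw [mul_left_comm t, Finset.mul_sum _ _ t]
    refine mul_le_mul_of_nonneg_left (Finset.sum_le_sum fun i _ => ?_) hc
    nlinarith [mul_nonneg (mul_nonneg ht.le (sub_nonneg.mpr ht1))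
      (sq_nonneg (f (x i) - fstar (x i)))]
end
end

section
/- Let F be a set, d a pseudo-distance on F (d(f,g) = d(g,f) ≥ 0), f* ∈ F, and T : F×F → R an antisymmetric family of test statistics, i.e. T(f,g) + T(g,f) = 0 for all f,g ∈ F. Define C(f) = sup{d(f,g) : g ∈ F, T(g,f) ≥ 0}. Then: (i) for all f, g ∈ F, d(f,g) ≤ max(C(f), C(g)); and (ii) any f̂ ∈ argmin_{f∈F} C(f) satisfies d(f̂, f*) ≤ C(f*). -/
/-- **Le Cam's risk bound from tests.** Let `d` be a pseudo-distance on `F`,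
`T` an antisymmetric family of tests and `C f = sup{d f g : T g f ≥ 0}` the `d`-radius of the
set of points beating `f` (computed in the extended reals). Then `d f g ≤ max (C f) (C g)`
for all `f, g` and any minimizer `f̂` of `C` satisfies `d f̂ f* ≤ C f*`. -/
theorem stmt19 {F : Type*} (d : F → F → ℝ)
    (hd_symm : ∀ f g, d f g = d g f) (hd_nonneg : ∀ f g, 0 ≤ d f g)
    (T : F → F → ℝ) (hT : ∀ f g, T f g + T g f = 0)
    (fstar : F) (C : F → EReal)
    (hC : ∀ f, C f = ⨆ g ∈ {g | 0 ≤ T g f}, (d f g : EReal)) :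
    (∀ f g, (d f g : EReal) ≤ max (C f) (C g)) ∧
    ∀ fhat : F, (∀ f, C fhat ≤ C f) → (d fhat fstar : EReal) ≤ C fstar := by
  have hle : ∀ f g, 0 ≤ T g f → (d f g : EReal) ≤ C f := fun f g h => by
    rw [hC f]
    exact le_iSup₂ (f := fun g (_ : g ∈ {g | 0 ≤ T g f}) => (d f g : EReal)) g h
  have hmax : ∀ f g, (d f g : EReal) ≤ max (C f) (C g) := fun f g => by
    rcases le_total 0 (T g f) with h | h
    · exact (hle f g h).trans (le_max_left _ _)
    · rw [hd_symm f g]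
      exact (hle g f (by linarith [hT f g])).trans (le_max_right _ _)
  exact ⟨hmax, fun fhat hmin => (hmax fhat fstar).trans (max_le (hmin fstar) le_rfl)⟩
end
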